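/- Let G be an m-vertex graph with independence number α(G) ≤ s (where s ≥ 1, m ≥ 1). Then G has a (nonempty) subgraph with minimum degree at least m/s − 1. -/

import Mathlib

/-- `S` is an independent set of the graph `G`. -/
def IndepSet {V : Type} (G : SimpleGraph V) (S : Finset V) : Prop :=
  ∀ u ∈ S, ∀ v ∈ S, ¬ G.Adj u v

open Classical in
/-- If every nonempty set of vertices induces a subgraph with a vertex of degree less than `d`, then
the greedy algorithm finds in each `U` an independent set of size at least `#U / d`. -/
theorem exists_indepSet_card_le_mul {V : Type} (G : SimpleGraph V) (d : ℕ)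
    (h : ∀ U : Finset V, U.Nonempty → ∃ v ∈ U, (U.filter (G.Adj v)).card < d) (U : Finset V) :
    ∃ S ⊆ U, IndepSet G S ∧ U.card ≤ S.card * d := by
  induction U using Finset.strongInduction with
  | H U ih =>
    rcases U.eq_empty_or_nonempty with rfl | hU
    · exact ⟨∅, by simp, by simp [IndepSet], by simp⟩
    obtain ⟨v, hv, hd⟩ := h U hU
    set N := insert v (U.filter (G.Adj v)) with hN
    have hNU : N ⊆ U := Finset.insert_subset hv (Finset.filter_subset _ _)
    have hcN : N.card ≤ d := (Finset.card_insert_le _ _).trans hd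
    obtain ⟨S, hSU, hS, hcS⟩ := ih (U \ N) (Finset.sdiff_ssubset hNU ⟨v, by simp [hN]⟩)
    have hSv : ∀ u ∈ S, u ∈ U ∧ u ≠ v ∧ ¬ G.Adj v u := by
      intro u hu
      have := hSU hu
      simp only [hN, Finset.mem_sdiff, Finset.mem_insert, Finset.mem_filter] at this
      tauto
    refine ⟨insert v S, Finset.insert_subset hv fun u hu => (hSv u hu).1, ?_, ?_⟩
    · intro a ha b hb
      rcases Finset.mem_insert.1 ha with rfl | haS <;> rcases Finset.mem_insert.1 hb with rfl | hbS
      · exact G.irrefl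
      · exact (hSv b hbS).2.2
      · exact fun hab => (hSv a haS).2.2 hab.symm
      · exact hS a haS b hbS
    · rw [Finset.card_insert_of_notMem fun hvS => (hSv v hvS).2.1 rfl, add_mul, one_mul]
      have := Finset.card_sdiff_add_card_eq_card hNU
      omega

/-- Every `m`-vertex graph `G` with independence number at most `s` (`s ≥ 1`, `m ≥ 1`)
has a nonempty (induced) subgraph with minimum degree at least `m/s - 1`. -/
theorem stmt_13 (m : ℕ) (hm : 1 ≤ m) (V : Type) [Fintype V] (hcard : Fintype.card V = m)
    (G : SimpleGraph V) (s : ℕ) (hs : 1 ≤ s)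
    (halpha : ∀ S : Finset V, IndepSet G S → S.card ≤ s) :
    ∃ U : Finset V, U.Nonempty ∧ ∀ v ∈ U,
      (m : ℝ) / (s : ℝ) - 1 ≤ (Nat.card {u : V // u ∈ U ∧ G.Adj v u} : ℝ) := by
  classical
  by_contra! hlow
  obtain ⟨S, -, hS, hcS⟩ := exists_indepSet_card_le_mul G ((m - 1) / s) (fun U hU => by
    obtain ⟨v, hv, hlt⟩ := hlow U hU
    refine ⟨v, hv, ?_⟩
    have hdeg : Nat.card {u : V // u ∈ U ∧ G.Adj v u} = (U.filter (G.Adj v)).card :=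
      Nat.subtype_card _ (by simp)
    rw [hdeg, lt_sub_iff_add_lt, lt_div_iff₀ (by exact_mod_cast hs)] at hlt
    norm_cast at hlt
    rw [← Nat.succ_le_iff, Nat.le_div_iff_mul_le hs]
    exact Nat.le_sub_one_of_lt hlt) Finset.univ
  rw [Finset.card_univ, hcard] at hcS
  have hle := Nat.mul_le_mul_right ((m - 1) / s) (halpha S hS)
  have := Nat.mul_div_le (m - 1) s
  omega
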